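/- Let I : (−∞,16) → ℝ be defined by I(t) := ∫_{(0,∞)³} ((1+x+y+z)(1+1/x+1/y+1/z) − t)^{−1} dx dy dz/(xyz). Then I is three times differentiable on (−∞,16) and satisfies the inhomogeneous Picard–Fuchs equation t²(t−4)(t−16)·I'''(t) + 6t(t²−15t+32)·I''(t) + (7t²−68t+64)·I'(t) + (t−4)·I(t) = −24 for every t ∈ (−∞,16). -/

import Mathlib

open MeasureTheory

/-- The equal-mass three-banana Feynman integral
`I(t) = ∫_{(0,∞)³} ((1+x+y+z)(1+1/x+1/y+1/z) − t)⁻¹ dx dy dz/(xyz)`. -/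
noncomputable def bananaI (t : ℝ) : ℝ :=
  ∫ p in Set.Ioi (0:ℝ) ×ˢ (Set.Ioi (0:ℝ) ×ˢ Set.Ioi (0:ℝ)),
    ((1 + p.1 + p.2.1 + p.2.2) * (1 + 1/p.1 + 1/p.2.1 + 1/p.2.2) - t)⁻¹ /
      (p.1 * p.2.1 * p.2.2)

section BesselMoments

open Set Filter Real Topology

/-- The Bessel-type integrals `∫₀^∞ a⁻ʲ exp (-a - s / a) da`. -/
noncomputable def expInvIntegral (j : ℕ) (s : ℝ) : ℝ :=
  ∫ a in Ioi (0 : ℝ), exp (-a - s / a) / a ^ j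

lemma rpow_mul_exp_neg_le {p x : ℝ} (hp : 0 < p) (hx : 0 < x) :
    exp (-x) ≤ p ^ p * x ^ (-p) := by
  have h1 : (x / p) ^ p ≤ exp (x / p) ^ p :=
    rpow_le_rpow (by positivity) ((by linarith : x / p ≤ x / p + 1).trans (add_one_le_exp _)) hp.le
  rw [← exp_mul, div_mul_cancel₀ _ hp.ne', div_rpow hx.le hp.le, div_le_iff₀ (by positivity)] at h1
  rw [exp_neg, rpow_neg hx.le, ← div_eq_mul_inv, inv_eq_one_div,
    div_le_div_iff₀ (exp_pos _) (by positivity)]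
  linarith

lemma expInv_le {j : ℕ} {p s a : ℝ} (hp : 0 < p) (hs : 0 < s) (ha : 0 < a) :
    exp (-a - s / a) / a ^ j ≤ p ^ p * s ^ (-p) * (exp (-a) * a ^ (p - j + 1 - 1)) := by
  have h1 := rpow_mul_exp_neg_le hp (div_pos hs ha)
  rw [div_rpow hs.le ha.le, rpow_neg ha.le, div_inv_eq_mul] at h1
  rw [sub_eq_add_neg, exp_add, add_sub_cancel_right, rpow_sub ha, rpow_natCast,
    div_le_iff₀ (by positivity)]
  calc exp (-a) * exp (-(s / a)) ≤ exp (-a) * (p ^ p * (s ^ (-p) * a ^ p)) := by gcongr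
    _ = _ := by field_simp

lemma measurable_expInv (j : ℕ) (s : ℝ) : Measurable fun a : ℝ ↦ exp (-a - s / a) / a ^ j := by
  fun_prop

lemma integrableOn_expInv (j : ℕ) {s : ℝ} (hs : 0 < s) :
    IntegrableOn (fun a : ℝ ↦ exp (-a - s / a) / a ^ j) (Ioi 0) := by
  have hp : (0 : ℝ) < j + 1 := by positivity
  refine Integrable.mono' ((Real.GammaIntegral_convergent
    (s := (j + 1 : ℝ) - j + 1) (by simp)).const_mul
      (((j : ℝ) + 1) ^ ((j : ℝ) + 1) * s ^ (-((j : ℝ) + 1))))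
    (measurable_expInv j s).aestronglyMeasurable ?_
  filter_upwards [ae_restrict_mem measurableSet_Ioi] with a ha
  have ha : 0 < a := ha
  rw [norm_of_nonneg (by positivity)]
  exact expInv_le hp hs ha

lemma expInvIntegral_nonneg (j : ℕ) (s : ℝ) : 0 ≤ expInvIntegral j s := by
  refine setIntegral_nonneg measurableSet_Ioi fun a ha ↦ ?_
  have ha : 0 < a := ha
  positivity

lemma exists_expInvIntegral_le (j : ℕ) {p : ℝ} (hp : 0 < p) (hj : (j : ℝ) < p + 1) :
    ∃ C, 0 ≤ C ∧ ∀ s, 0 < s → expInvIntegral j s ≤ C * s ^ (-p) := by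
  refine ⟨p ^ p * Gamma (p - j + 1), mul_nonneg (by positivity) (Gamma_pos_of_pos (by linarith)).le,
    fun s hs ↦ ?_⟩
  calc expInvIntegral j s
      ≤ ∫ a in Ioi (0 : ℝ), p ^ p * s ^ (-p) * (exp (-a) * a ^ (p - j + 1 - 1)) :=
        setIntegral_mono_on (integrableOn_expInv j hs)
          ((Real.GammaIntegral_convergent (by linarith)).const_mul _) measurableSet_Ioi
          fun a ha ↦ expInv_le hp hs ha
    _ = _ := by
        rw [integral_const_mul, ← Gamma_eq_integral (by linarith)]
        ring

lemma hasDerivAt_expInvIntegral (j : ℕ) {s : ℝ} (hs : 0 < s) :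
    HasDerivAt (expInvIntegral j) (-expInvIntegral (j + 1) s) s := by
  have hs2 : 0 < s / 2 := half_pos hs
  have key := (hasDerivAt_integral_of_dominated_loc_of_deriv_le (μ := volume.restrict (Ioi (0 : ℝ)))
    (F := fun s a ↦ exp (-a - s / a) / a ^ j) (F' := fun s a ↦ -(exp (-a - s / a) / a ^ (j + 1)))
    (bound := fun a ↦ exp (-a - (s / 2) / a) / a ^ (j + 1)) (x₀ := s) (s := Ioi (s / 2))
    (Ioi_mem_nhds (by linarith))
    (.of_forall fun x ↦ (measurable_expInv j x).aestronglyMeasurable)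
    (integrableOn_expInv j hs) (measurable_expInv (j + 1) s).neg.aestronglyMeasurable
    ?_ (integrableOn_expInv (j + 1) hs2) ?_).2
  · rw [integral_neg] at key
    exact key
  · filter_upwards [ae_restrict_mem measurableSet_Ioi] with a ha x hx
    have ha : 0 < a := ha
    have hx : s / 2 < x := hx
    rw [norm_neg, norm_of_nonneg (by positivity)]
    gcongr
  · filter_upwards [ae_restrict_mem measurableSet_Ioi] with a ha x hx
    have ha : 0 < a := ha
    have h := ((((hasDerivAt_id x).div_const a).const_sub (-a)).exp).div_const (a ^ j)
    refine h.congr_deriv ?_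
    simp only [id]
    field_simp
    ring

lemma tendsto_expInv_nhdsGT_zero {s : ℝ} (hs : 0 < s) :
    Tendsto (fun a : ℝ ↦ exp (-a - s / a)) (𝓝[>] 0) (𝓝 0) := by
  refine tendsto_exp_atBot.comp ?_
  have h1 : Tendsto (fun a : ℝ ↦ s / a) (𝓝[>] 0) atTop :=
    (tendsto_inv_nhdsGT_zero.const_mul_atTop hs).congr fun a ↦ by rw [div_eq_mul_inv]
  have h2 : Tendsto (fun a : ℝ ↦ -a) (𝓝[>] 0) (𝓝 0) := by
    simpa using (continuous_neg.tendsto (0 : ℝ)).mono_left nhdsWithin_le_nhds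
  simpa [sub_eq_add_neg] using h2.add_atBot (tendsto_neg_atTop_atBot.comp h1)

lemma tendsto_expInv_atTop {s : ℝ} (hs : 0 < s) :
    Tendsto (fun a : ℝ ↦ exp (-a - s / a)) atTop (𝓝 0) := by
  refine squeeze_zero' (.of_forall fun a ↦ (exp_pos _).le) ?_
    (tendsto_exp_atBot.comp tendsto_neg_atTop_atBot)
  filter_upwards [eventually_gt_atTop 0] with a ha
  simp only [Function.comp]
  gcongr
  have : 0 < s / a := by positivity
  linarith

lemma expInvIntegral_two {s : ℝ} (hs : 0 < s) :
    s * expInvIntegral 2 s = expInvIntegral 0 s := by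
  have h2 := (integrableOn_expInv 2 hs).const_mul s
  have h0 := integrableOn_expInv 0 hs
  have key := integral_Ioi_deriv_mul_eq_sub (a := (0 : ℝ)) (u := fun _ : ℝ ↦ (1 : ℝ))
    (u' := fun _ ↦ 0)
    (v := fun a ↦ exp (-a - s / a))
    (v' := fun a ↦ s * (exp (-a - s / a) / a ^ 2) - exp (-a - s / a) / a ^ 0) (a' := 0) (b' := 0)
    (fun x _ ↦ hasDerivAt_const _ _) ?_ ?_ ?_ ?_
  · simp only [zero_mul, one_mul, zero_add, sub_zero] at key
    rw [integral_sub h2 h0, integral_const_mul] at key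
    exact sub_eq_zero.1 key
  · intro a ha
    have ha : 0 < a := ha
    have h := (((hasDerivAt_id a).neg).sub ((hasDerivAt_inv ha.ne').const_mul s)).exp
    simp only [← div_eq_mul_inv] at h
    refine h.congr_deriv ?_
    simp
    field_simp
    ring
  · refine (h2.sub h0).congr (.of_forall fun a ↦ ?_)
    simp
  · refine (tendsto_expInv_nhdsGT_zero hs).congr fun a ↦ by simp
  · refine (tendsto_expInv_atTop hs).congr fun a ↦ by simp

lemma tendsto_expInvIntegral_zero : Tendsto (expInvIntegral 0) (𝓝[>] 0) (𝓝 1) := by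
  have h1 : ∫ a in Ioi (0 : ℝ), exp (-a) = 1 := integral_exp_neg_Ioi_zero
  rw [← h1]
  refine tendsto_integral_filter_of_dominated_convergence (fun a ↦ exp (-a))
    (.of_forall fun s ↦ (measurable_expInv 0 s).aestronglyMeasurable) ?_ ?_ ?_
  · filter_upwards [self_mem_nhdsWithin] with s hs
    filter_upwards [ae_restrict_mem measurableSet_Ioi] with a ha
    have ha : 0 < a := ha
    have hs : 0 < s := hs
    have : 0 < s / a := by positivity
    rw [norm_of_nonneg (by positivity), pow_zero, div_one]
    gcongr
    linarith
  · simpa [IntegrableOn] using Real.GammaIntegral_convergent one_pos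
  · filter_upwards [ae_restrict_mem measurableSet_Ioi] with a ha
    have : Continuous fun s : ℝ ↦ exp (-a - s / a) / a ^ 0 := by fun_prop
    simpa using (this.tendsto 0).mono_left nhdsWithin_le_nhds

lemma exists_expInvIntegral_monomial_le (m i : ℕ) {p : ℝ} (hp : 0 < p) (hi : i ≤ 4) :
    ∃ C, 0 ≤ C ∧ ∀ s, 0 < s →
      s ^ m * (expInvIntegral 1 s ^ i * expInvIntegral 0 s ^ (4 - i)) ≤ C * s ^ (m - 4 * p) := by
  obtain ⟨C, hC, hk⟩ := exists_expInvIntegral_le 1 hp (by simpa using hp)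
  obtain ⟨D, hD, hg⟩ := exists_expInvIntegral_le 0 hp (by simp; linarith)
  refine ⟨C ^ i * D ^ (4 - i), by positivity, fun s hs ↦ ?_⟩
  calc s ^ m * (expInvIntegral 1 s ^ i * expInvIntegral 0 s ^ (4 - i))
      ≤ s ^ m * ((C * s ^ (-p)) ^ i * (D * s ^ (-p)) ^ (4 - i)) := by
        have h1 := pow_le_pow_left₀ (expInvIntegral_nonneg 1 s) (hk s hs) i
        have h2 := pow_le_pow_left₀ (expInvIntegral_nonneg 0 s) (hg s hs) (4 - i)
        have := expInvIntegral_nonneg 0 s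
        gcongr
    _ = C ^ i * D ^ (4 - i) * (s ^ m * ((s ^ (-p)) ^ i * (s ^ (-p)) ^ (4 - i))) := by ring
    _ = _ := by
        rw [← pow_add, Nat.add_sub_cancel' hi, ← rpow_mul_natCast hs.le, ← rpow_natCast s m,
          ← rpow_add hs]
        congr 2
        push_cast
        ring

lemma tendsto_expInvIntegral_monomial_atTop (m i : ℕ) (hi : i ≤ 4) :
    Tendsto (fun s ↦ s ^ m * (expInvIntegral 1 s ^ i * expInvIntegral 0 s ^ (4 - i)))
      atTop (𝓝 0) := by
  obtain ⟨C, -, h⟩ := exists_expInvIntegral_monomial_le m i (p := (m + 1) / 4) (by positivity) hi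
  refine squeeze_zero' (g := fun s ↦ C * s ^ (-1 : ℝ)) ?_ ?_ ?_
  · filter_upwards [eventually_gt_atTop 0] with s hs
    have := expInvIntegral_nonneg 0 s
    have := expInvIntegral_nonneg 1 s
    positivity
  · filter_upwards [eventually_gt_atTop 0] with s hs
    convert h s hs using 3
    ring
  · simpa using (tendsto_rpow_neg_atTop one_pos).const_mul C

lemma tendsto_expInvIntegral_monomial_zero (m i : ℕ) (hi : i ≤ 4) :
    Tendsto (fun s ↦ s ^ (m + 1) * (expInvIntegral 1 s ^ i * expInvIntegral 0 s ^ (4 - i)))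
      (𝓝[>] 0) (𝓝 0) := by
  obtain ⟨C, -, h⟩ := exists_expInvIntegral_monomial_le (m + 1) i (p := 1 / 8) (by positivity) hi
  refine squeeze_zero' (g := fun s ↦ C * s ^ (m + 1 / 2 : ℝ)) ?_ ?_ ?_
  · filter_upwards [self_mem_nhdsWithin] with s hs
    have hs : 0 < s := hs
    have := expInvIntegral_nonneg 0 s
    have := expInvIntegral_nonneg 1 s
    positivity
  · filter_upwards [self_mem_nhdsWithin] with s hs
    convert h s hs using 3
    push_cast
    ring
  · have h0 : (0 : ℝ) < m + 1 / 2 := by positivity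
    have := (continuousAt_rpow_const 0 (m + 1 / 2 : ℝ) (.inr h0.le)).tendsto
    rw [zero_rpow h0.ne'] at this
    simpa using (this.mono_left nhdsWithin_le_nhds).const_mul C

lemma continuousOn_expInvIntegral (j : ℕ) : ContinuousOn (expInvIntegral j) (Ioi 0) :=
  fun _ hs ↦ (hasDerivAt_expInvIntegral j hs).continuousAt.continuousWithinAt

lemma integrableOn_moment (n : ℕ) :
    IntegrableOn (fun s ↦ s ^ n * expInvIntegral 1 s ^ 4) (Ioi 0) := by
  have hc : ContinuousOn (fun s ↦ s ^ n * expInvIntegral 1 s ^ 4) (Ioi 0) :=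
    (continuousOn_pow n).mul ((continuousOn_expInvIntegral 1).pow 4)
  rw [← Ioc_union_Ioi_eq_Ioi zero_le_one, integrableOn_union]
  constructor
  · obtain ⟨C, -, h⟩ := exists_expInvIntegral_monomial_le n 4 (p := 1 / 8) (by positivity) le_rfl
    have hi : IntegrableOn (fun s : ℝ ↦ C * s ^ (n - 4 * (1 / 8) : ℝ)) (Ioc 0 1) := by
      refine Integrable.const_mul ?_ C
      rw [← IntegrableOn, ← intervalIntegrable_iff_integrableOn_Ioc_of_le zero_le_one]
      refine intervalIntegral.intervalIntegrable_rpow' ?_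
      have : (0 : ℝ) ≤ n := n.cast_nonneg
      linarith
    refine hi.mono' ((hc.mono Ioc_subset_Ioi_self).aestronglyMeasurable measurableSet_Ioc) ?_
    filter_upwards [ae_restrict_mem measurableSet_Ioc] with s hs
    have hs : 0 < s := hs.1
    have := expInvIntegral_nonneg 1 s
    rw [norm_of_nonneg (by positivity)]
    simpa using h s hs
  · obtain ⟨C, -, h⟩ :=
      exists_expInvIntegral_monomial_le n 4 (p := (n + 2) / 4) (by positivity) le_rfl
    have hi : IntegrableOn (fun s : ℝ ↦ C * s ^ (n - 4 * ((n + 2) / 4) : ℝ)) (Ioi 1) := by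
      refine Integrable.const_mul (integrableOn_Ioi_rpow_of_lt ?_ one_pos) C
      linarith
    refine hi.mono' ((hc.mono (Ioi_subset_Ioi zero_le_one)).aestronglyMeasurable
      measurableSet_Ioi) ?_
    filter_upwards [ae_restrict_mem measurableSet_Ioi] with s hs
    have hs : 0 < s := one_pos.trans hs
    have := expInvIntegral_nonneg 1 s
    rw [norm_of_nonneg (by positivity)]
    simpa using h s hs

/-- The moments `∫₀^∞ sⁿ k(s)⁴ ds` of the Bessel function `k(s) = 2 K₀(2√s)`. -/
noncomputable def besselMoment (n : ℕ) : ℝ :=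
  ∫ s in Ioi (0 : ℝ), s ^ n * expInvIntegral 1 s ^ 4

/-- A primitive realising the three-term relation between the Bessel moments. -/
noncomputable def momentPrimitive (n : ℕ) (s : ℝ) : ℝ :=
  s ^ n * (n ^ 4 * expInvIntegral 1 s ^ 4
    + 4 * n ^ 3 * (expInvIntegral 1 s ^ 3 * expInvIntegral 0 s)
    + 12 * n ^ 2 * (expInvIntegral 1 s ^ 2 * expInvIntegral 0 s ^ 2)
    + 24 * n * (expInvIntegral 1 s * expInvIntegral 0 s ^ 3)
    + 24 * expInvIntegral 0 s ^ 4
    + s * (-(16 * n ^ 2 + 14 * n + 4) * expInvIntegral 1 s ^ 4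
      - (40 * n + 16) * (expInvIntegral 1 s ^ 3 * expInvIntegral 0 s)
      - 48 * (expInvIntegral 1 s ^ 2 * expInvIntegral 0 s ^ 2))
    + 24 * s ^ 2 * expInvIntegral 1 s ^ 4)

lemma hasDerivAt_momentPrimitive (n : ℕ) {s : ℝ} (hs : 0 < s) :
    HasDerivAt (momentPrimitive n)
      (n ^ 5 * (s ^ (n - 1) * expInvIntegral 1 s ^ 4)
        - 2 * (2 * n + 1) * (5 * n ^ 2 + 5 * n + 2) * (s ^ n * expInvIntegral 1 s ^ 4)
        + 64 * (n + 1) * (s ^ (n + 1) * expInvIntegral 1 s ^ 4)) s := by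
  have hk := hasDerivAt_expInvIntegral 1 hs
  have hg := hasDerivAt_expInvIntegral 0 hs
  have h2 : expInvIntegral 2 s = expInvIntegral 0 s / s := by
    rw [← expInvIntegral_two hs]
    field_simp
  norm_num only at hk hg
  rw [h2] at hk
  have hid := hasDerivAt_id' s
  have H := (hid.pow n).mul ((((((((hk.pow 4).const_mul ((n : ℝ) ^ 4)).add
    (((hk.pow 3).mul hg).const_mul (4 * (n : ℝ) ^ 3))).add
    (((hk.pow 2).mul (hg.pow 2)).const_mul (12 * (n : ℝ) ^ 2))).add
    ((hk.mul (hg.pow 3)).const_mul (24 * (n : ℝ)))).add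
    ((hg.pow 4).const_mul 24)).add
    (hid.mul ((((hk.pow 4).const_mul (-(16 * (n : ℝ) ^ 2 + 14 * n + 4))).sub
      (((hk.pow 3).mul hg).const_mul (40 * (n : ℝ) + 16))).sub
      (((hk.pow 2).mul (hg.pow 2)).const_mul 48)))).add
    (((hid.pow 2).const_mul 24).mul (hk.pow 4)))
  refine H.congr_deriv ?_
  simp only [Pi.add_apply, Pi.mul_apply, Pi.sub_apply, Pi.pow_apply]
  generalize expInvIntegral 1 s = k
  generalize expInvIntegral 0 s = g
  rcases n with _ | n
  · simp
    field_simp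
    ring
  · simp only [Nat.add_sub_cancel]
    push_cast
    field_simp
    ring

lemma tendsto_momentPrimitive_atTop (n : ℕ) :
    Tendsto (momentPrimitive n) atTop (𝓝 0) := by
  have h (m i : ℕ) (hi : i ≤ 4) (c : ℝ) :=
    (tendsto_expInvIntegral_monomial_atTop m i hi).const_mul c
  have H := (((((((((h n 4 (by norm_num) ((n : ℝ) ^ 4)).add
    (h n 3 (by norm_num) (4 * (n : ℝ) ^ 3))).add
    (h n 2 (by norm_num) (12 * (n : ℝ) ^ 2))).add
    (h n 1 (by norm_num) (24 * (n : ℝ)))).add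
    (h n 0 (by norm_num) 24)).add
    (h (n + 1) 4 (by norm_num) (-(16 * (n : ℝ) ^ 2 + 14 * n + 4)))).sub
    (h (n + 1) 3 (by norm_num) (40 * (n : ℝ) + 16))).sub
    (h (n + 1) 2 (by norm_num) 48)).add
    (h (n + 2) 4 (by norm_num) 24))
  simp only [mul_zero, add_zero, sub_zero] at H
  refine H.congr fun s ↦ ?_
  simp only [momentPrimitive]
  norm_num
  ring

lemma tendsto_momentPrimitive_zero_succ (n : ℕ) :
    Tendsto (momentPrimitive (n + 1)) (𝓝[>] 0) (𝓝 0) := by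
  have h (m i : ℕ) (hi : i ≤ 4) (c : ℝ) :=
    (tendsto_expInvIntegral_monomial_zero m i hi).const_mul c
  have H := (((((((((h n 4 (by norm_num) ((n + 1 : ℝ) ^ 4)).add
    (h n 3 (by norm_num) (4 * (n + 1 : ℝ) ^ 3))).add
    (h n 2 (by norm_num) (12 * (n + 1 : ℝ) ^ 2))).add
    (h n 1 (by norm_num) (24 * (n + 1 : ℝ)))).add
    (h n 0 (by norm_num) 24)).add
    (h (n + 1) 4 (by norm_num) (-(16 * (n + 1 : ℝ) ^ 2 + 14 * (n + 1) + 4)))).sub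
    (h (n + 1) 3 (by norm_num) (40 * (n + 1 : ℝ) + 16))).sub
    (h (n + 1) 2 (by norm_num) 48)).add
    (h (n + 2) 4 (by norm_num) 24))
  simp only [mul_zero, add_zero, sub_zero] at H
  refine H.congr fun s ↦ ?_
  simp only [momentPrimitive]
  norm_num
  ring

lemma tendsto_momentPrimitive_zero_zero :
    Tendsto (momentPrimitive 0) (𝓝[>] 0) (𝓝 24) := by
  have h (m i : ℕ) (hi : i ≤ 4) (c : ℝ) :=
    (tendsto_expInvIntegral_monomial_zero m i hi).const_mul c
  have H := (((((tendsto_expInvIntegral_zero.pow 4).const_mul 24).add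
    (h 0 4 (by norm_num) (-4))).sub
    (h 0 3 (by norm_num) 16)).sub
    (h 0 2 (by norm_num) 48)).add
    (h 1 4 (by norm_num) 24)
  simp only [mul_zero, add_zero, sub_zero, one_pow, mul_one] at H
  refine H.congr fun s ↦ ?_
  simp only [momentPrimitive]
  norm_num
  ring

lemma besselMoment_relation (n : ℕ) {b : ℝ} (hb : Tendsto (momentPrimitive n) (𝓝[>] 0) (𝓝 b)) :
    n ^ 5 * besselMoment (n - 1)
      - 2 * (2 * n + 1) * (5 * n ^ 2 + 5 * n + 2) * besselMoment n
      + 64 * (n + 1) * besselMoment (n + 1) = -b := by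
  have h (m : ℕ) (c : ℝ) := (integrableOn_moment m).const_mul c
  have hi := ((h (n - 1) ((n : ℝ) ^ 5)).sub
    (h n (2 * (2 * n + 1) * (5 * n ^ 2 + 5 * n + 2)))).add (h (n + 1) (64 * (n + 1)))
  have key := integral_Ioi_deriv_mul_eq_sub (a := (0 : ℝ)) (u := fun _ : ℝ ↦ (1 : ℝ))
    (u' := fun _ ↦ 0) (v := momentPrimitive n) (a' := b) (b' := 0)
    (fun x _ ↦ hasDerivAt_const _ _) (fun s hs ↦ hasDerivAt_momentPrimitive n hs)
    (hi.congr (.of_forall fun a ↦ by simp)) (hb.congr fun a ↦ by simp)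
    ((tendsto_momentPrimitive_atTop n).congr fun a ↦ by simp)
  simp only [zero_mul, one_mul, zero_add, zero_sub] at key
  have hsub : Integrable (fun s ↦ n ^ 5 * (s ^ (n - 1) * expInvIntegral 1 s ^ 4)
      - 2 * (2 * n + 1) * (5 * n ^ 2 + 5 * n + 2) * (s ^ n * expInvIntegral 1 s ^ 4))
      (volume.restrict (Ioi 0)) := (h _ _).sub (h _ _)
  rw [← key, integral_add hsub (h _ _), integral_sub (h _ _) (h _ _),
    integral_const_mul, integral_const_mul, integral_const_mul]
  rfl

lemma besselMoment_zero_relation : -4 * besselMoment 0 + 64 * besselMoment 1 = -24 := by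
  have := besselMoment_relation 0 tendsto_momentPrimitive_zero_zero
  norm_num at this
  linarith

lemma besselMoment_succ_relation (n : ℕ) :
    ((n : ℝ) + 1) ^ 5 * besselMoment n
      - 2 * (2 * n + 3) * (5 * (n + 1) ^ 2 + 5 * n + 7) * besselMoment (n + 1)
      + 64 * (n + 2) * besselMoment (n + 2) = 0 := by
  have := besselMoment_relation (n + 1) (tendsto_momentPrimitive_zero_succ n)
  simp only [Nat.add_sub_cancel] at this
  push_cast at this
  linear_combination this

end BesselMoments

section MomentFormula

open Set Filter Real Topology
open scoped ENNReal

lemma setLIntegral_Ioi_comp_mul_left {f : ℝ → ℝ≥0∞} (hf : Measurable f) {c : ℝ} (hc : 0 < c) :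
    ∫⁻ x in Ioi (0 : ℝ), f (c * x) = ENNReal.ofReal c⁻¹ * ∫⁻ x in Ioi (0 : ℝ), f x := by
  have h := setLIntegral_map (μ := volume) (measurableSet_Ioi (a := (0 : ℝ))) hf
    (measurable_const_mul c)
  have hpre : (fun x ↦ c * x) ⁻¹' Ioi (0 : ℝ) = Ioi 0 := by
    ext x
    simp [hc]
  rw [Real.map_volume_mul_left hc.ne', hpre, Measure.restrict_smul, lintegral_smul_measure,
    abs_of_pos (inv_pos.2 hc)] at h
  exact h.symm

lemma setLIntegral_pow_mul_exp_neg (n : ℕ) {c : ℝ} (hc : 0 < c) :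
    ∫⁻ a in Ioi (0 : ℝ), ENNReal.ofReal (a ^ n * exp (-(c * a)))
      = ENNReal.ofReal (n.factorial / c ^ (n + 1)) := by
  have h := integral_rpow_mul_exp_neg_mul_Ioi (a := n + 1) (by positivity) hc
  simp only [add_sub_cancel_right, rpow_natCast, Gamma_nat_eq_factorial] at h
  rw [← ofReal_integral_eq_lintegral_ofReal, h]
  · congr 1
    rw [← Nat.cast_succ, rpow_natCast]
    simp [div_eq_mul_inv, mul_comm]
  · refine .of_integral_ne_zero ?_
    rw [h]
    positivity
  · filter_upwards [ae_restrict_mem measurableSet_Ioi] with a ha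
    have ha : 0 < a := ha
    show 0 ≤ _
    positivity

lemma setLIntegral_exp_sub_div {a b : ℝ} (ha : 0 < a) (hb : 0 < b) :
    ∫⁻ x in Ioi (0 : ℝ), ENNReal.ofReal (exp (-(a * x) - b / x) / x)
      = ENNReal.ofReal (expInvIntegral 1 (a * b)) := by
  have h := setLIntegral_Ioi_comp_mul_left
    (f := fun u ↦ ENNReal.ofReal (exp (-u - a * b / u) / u ^ 1)) (by fun_prop) ha
  rw [expInvIntegral, ofReal_integral_eq_lintegral_ofReal (integrableOn_expInv 1 (mul_pos ha hb))]
  · have h2 : ∫⁻ x in Ioi (0 : ℝ), ENNReal.ofReal (exp (-(a * x) - b / x) / x)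
        = ENNReal.ofReal a * ∫⁻ x in Ioi (0 : ℝ),
          ENNReal.ofReal (exp (-(a * x) - a * b / (a * x)) / (a * x) ^ 1) := by
      rw [← lintegral_const_mul _ (by fun_prop)]
      refine setLIntegral_congr_fun measurableSet_Ioi fun x hx ↦ ?_
      have hx : 0 < x := hx
      rw [← ENNReal.ofReal_mul ha.le, mul_div_mul_left _ _ ha.ne', pow_one]
      congr 1
      field_simp
    rw [h2, h, ← mul_assoc, ← ENNReal.ofReal_mul ha.le, mul_inv_cancel₀ ha.ne', ENNReal.ofReal_one,
      one_mul]
  · filter_upwards [ae_restrict_mem measurableSet_Ioi] with x hx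
    have hx : 0 < x := hx
    show 0 ≤ _
    positivity

lemma measurable_lintegral_exp_sub_div :
    Measurable fun s : ℝ ↦ ∫⁻ x in Ioi (0 : ℝ), ENNReal.ofReal (exp (-x - s / x) / x) :=
  Measurable.lintegral_prod_right' (f := fun q : ℝ × ℝ ↦
    ENNReal.ofReal (exp (-q.2 - q.1 / q.2) / q.2)) (by fun_prop)

lemma lintegral_besselMoment (n : ℕ) :
    ∫⁻ s in Ioi (0 : ℝ), ENNReal.ofReal (s ^ n)
        * (∫⁻ x in Ioi (0 : ℝ), ENNReal.ofReal (exp (-x - s / x) / x)) ^ 4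
      = ENNReal.ofReal (besselMoment n) := by
  rw [besselMoment, ofReal_integral_eq_lintegral_ofReal (integrableOn_moment n)]
  · refine setLIntegral_congr_fun measurableSet_Ioi fun s hs ↦ ?_
    have hs : 0 < s := hs
    have h := setLIntegral_exp_sub_div one_pos hs
    simp only [one_mul] at h
    rw [h, ← ENNReal.ofReal_pow (expInvIntegral_nonneg _ _), ENNReal.ofReal_mul (by positivity)]
  · filter_upwards [ae_restrict_mem measurableSet_Ioi] with s hs
    have hs : 0 < s := hs
    have := expInvIntegral_nonneg 1 s
    show 0 ≤ _
    positivity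

lemma lintegral_lintegral_besselMoment (n : ℕ) :
    ∫⁻ a in Ioi (0 : ℝ), ∫⁻ b in Ioi (0 : ℝ), ENNReal.ofReal (a ^ n * b ^ n * exp (-a) * exp (-b))
        * (∫⁻ x in Ioi (0 : ℝ), ENNReal.ofReal (exp (-x - a * b / x) / x)) ^ 3
      = ENNReal.ofReal (besselMoment n) := by
  have hK := measurable_lintegral_exp_sub_div
  rw [← lintegral_besselMoment]
  calc _ = ∫⁻ a in Ioi (0 : ℝ), ∫⁻ s in Ioi (0 : ℝ), ENNReal.ofReal (exp (-a - s / a) / a) *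
        (ENNReal.ofReal (s ^ n)
          * (∫⁻ x in Ioi (0 : ℝ), ENNReal.ofReal (exp (-x - s / x) / x)) ^ 3) := by
        refine setLIntegral_congr_fun measurableSet_Ioi fun a ha ↦ ?_
        have ha : 0 < a := ha
        have h := setLIntegral_Ioi_comp_mul_left (f := fun s ↦
          ENNReal.ofReal (a ^ n * (s / a) ^ n * exp (-a) * exp (-(s / a)))
          * (∫⁻ x in Ioi (0 : ℝ), ENNReal.ofReal (exp (-x - s / x) / x)) ^ 3) (by fun_prop) ha
        simp only [mul_div_cancel_left₀ _ ha.ne'] at h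
        rw [h, ← lintegral_const_mul _ (by fun_prop)]
        refine setLIntegral_congr_fun measurableSet_Ioi fun s hs ↦ ?_
        have hs : 0 < s := hs
        rw [← mul_assoc, ← mul_assoc, ← ENNReal.ofReal_mul (by positivity),
          ← ENNReal.ofReal_mul (by positivity)]
        congr 2
        rw [sub_eq_add_neg, exp_add, div_pow]
        field_simp
    _ = ∫⁻ s in Ioi (0 : ℝ), ∫⁻ a in Ioi (0 : ℝ), ENNReal.ofReal (exp (-a - s / a) / a) *
        (ENNReal.ofReal (s ^ n)
          * (∫⁻ x in Ioi (0 : ℝ), ENNReal.ofReal (exp (-x - s / x) / x)) ^ 3) := by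
        refine lintegral_lintegral_swap (Measurable.aemeasurable ?_)
        simp only [Function.uncurry_def]
        have h2 := hK.comp (measurable_snd : Measurable (Prod.snd : ℝ × ℝ → ℝ))
        simp only [Function.comp_def] at h2
        fun_prop
    _ = _ := by
        refine lintegral_congr fun s ↦ ?_
        rw [lintegral_mul_const _ (by fun_prop)]
        ring

/-- The integrand of the two-parameter Schwinger representation. -/
noncomputable def schwingerKernel (n : ℕ) (p : ℝ × ℝ × ℝ) (q : ℝ × ℝ) : ℝ≥0∞ :=
  ENNReal.ofReal (q.1 ^ n * q.2 ^ n * exp (-q.1) * exp (-q.2))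
    * (ENNReal.ofReal (exp (-(q.1 * p.1) - q.2 / p.1) / p.1)
    * (ENNReal.ofReal (exp (-(q.1 * p.2.1) - q.2 / p.2.1) / p.2.1)
    * ENNReal.ofReal (exp (-(q.1 * p.2.2) - q.2 / p.2.2) / p.2.2)))

lemma measurable_schwingerKernel (n : ℕ) :
    Measurable fun r : (ℝ × ℝ × ℝ) × ℝ × ℝ ↦ schwingerKernel n r.1 r.2 := by
  unfold schwingerKernel
  fun_prop

lemma lintegral_schwingerKernel_parameters (n : ℕ) {p : ℝ × ℝ × ℝ}
    (hp : p ∈ Ioi (0 : ℝ) ×ˢ (Ioi (0 : ℝ) ×ˢ Ioi (0 : ℝ))) :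
    ∫⁻ q in Ioi (0 : ℝ) ×ˢ Ioi (0 : ℝ), schwingerKernel n p q
      = ENNReal.ofReal ((n.factorial : ℝ) ^ 2 * ((((1 + p.1 + p.2.1 + p.2.2)
        * (1 + 1 / p.1 + 1 / p.2.1 + 1 / p.2.2))⁻¹) ^ (n + 1) / (p.1 * p.2.1 * p.2.2))) := by
  obtain ⟨x, y, z⟩ := p
  obtain ⟨hx : 0 < x, hy : 0 < y, hz : 0 < z⟩ := hp
  simp only
  have hA : 0 < 1 + x + y + z := by positivity
  have hB : 0 < 1 + 1 / x + 1 / y + 1 / z := by positivity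
  have h1 : ∀ q ∈ Ioi (0 : ℝ) ×ˢ Ioi (0 : ℝ), schwingerKernel n (x, y, z) q
      = ENNReal.ofReal (1 / (x * y * z)) *
      (ENNReal.ofReal (q.1 ^ n * exp (-((1 + x + y + z) * q.1)))
        * ENNReal.ofReal (q.2 ^ n * exp (-((1 + 1 / x + 1 / y + 1 / z) * q.2)))) := by
    rintro ⟨a, b⟩ ⟨ha : 0 < a, hb : 0 < b⟩
    simp only [schwingerKernel]
    rw [← ENNReal.ofReal_mul (by positivity), ← ENNReal.ofReal_mul (by positivity),
      ← ENNReal.ofReal_mul (by positivity), ← ENNReal.ofReal_mul (by positivity),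
      ← ENNReal.ofReal_mul (by positivity)]
    congr 1
    have e1 : exp (-((1 + x + y + z) * a)) = exp (-a) * exp (-(a * x)) * exp (-(a * y))
        * exp (-(a * z)) := by
      simp only [← exp_add]
      ring_nf
    have e2 : exp (-((1 + 1 / x + 1 / y + 1 / z) * b)) = exp (-b) * exp (-(b / x)) * exp (-(b / y))
        * exp (-(b / z)) := by
      simp only [← exp_add]
      ring_nf
    rw [e1, e2]
    simp only [sub_eq_add_neg, exp_add]
    field_simp
  rw [setLIntegral_congr_fun (measurableSet_Ioi.prod measurableSet_Ioi) h1,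
    lintegral_const_mul _ (by fun_prop), Measure.volume_eq_prod, ← Measure.prod_restrict,
    lintegral_prod_mul (f := fun a ↦ ENNReal.ofReal (a ^ n * exp (-((1 + x + y + z) * a))))
      (g := fun b ↦ ENNReal.ofReal (b ^ n * exp (-((1 + 1 / x + 1 / y + 1 / z) * b))))
      (by fun_prop) (by fun_prop),
    setLIntegral_pow_mul_exp_neg n hA, setLIntegral_pow_mul_exp_neg n hB,
    ← ENNReal.ofReal_mul (by positivity), ← ENNReal.ofReal_mul (by positivity)]
  congr 1
  rw [inv_pow, mul_pow]
  field_simp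

lemma lintegral_schwingerKernel_space (n : ℕ) {q : ℝ × ℝ}
    (hq : q ∈ Ioi (0 : ℝ) ×ˢ Ioi (0 : ℝ)) :
    ∫⁻ p in Ioi (0 : ℝ) ×ˢ (Ioi (0 : ℝ) ×ˢ Ioi (0 : ℝ)), schwingerKernel n p q
      = ENNReal.ofReal (q.1 ^ n * q.2 ^ n * exp (-q.1) * exp (-q.2))
        * (∫⁻ x in Ioi (0 : ℝ), ENNReal.ofReal (exp (-x - q.1 * q.2 / x) / x)) ^ 3 := by
  obtain ⟨a, b⟩ := q
  obtain ⟨ha : 0 < a, hb : 0 < b⟩ := hq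
  have h1 := setLIntegral_exp_sub_div one_pos (mul_pos ha hb)
  simp only [one_mul] at h1
  have hm : Measurable fun x : ℝ ↦ ENNReal.ofReal (exp (-(a * x) - b / x) / x) := by fun_prop
  simp only [schwingerKernel]
  rw [lintegral_const_mul _ (by fun_prop), Measure.volume_eq_prod, ← Measure.prod_restrict,
    Measure.volume_eq_prod, ← Measure.prod_restrict,
    lintegral_prod_mul (f := fun x ↦ ENNReal.ofReal (exp (-(a * x) - b / x) / x))
      (g := fun r : ℝ × ℝ ↦ ENNReal.ofReal (exp (-(a * r.1) - b / r.1) / r.1)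
        * ENNReal.ofReal (exp (-(a * r.2) - b / r.2) / r.2)) hm.aemeasurable (by fun_prop),
    lintegral_prod_mul (f := fun x ↦ ENNReal.ofReal (exp (-(a * x) - b / x) / x))
      (g := fun x ↦ ENNReal.ofReal (exp (-(a * x) - b / x) / x)) hm.aemeasurable hm.aemeasurable,
    setLIntegral_exp_sub_div ha hb, h1]
  ring

lemma lintegral_inv_pow_eq_besselMoment (n : ℕ) :
    ∫⁻ p in Ioi (0 : ℝ) ×ˢ (Ioi (0 : ℝ) ×ˢ Ioi (0 : ℝ)),
        ENNReal.ofReal ((n.factorial : ℝ) ^ 2 * ((((1 + p.1 + p.2.1 + p.2.2)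
        * (1 + 1 / p.1 + 1 / p.2.1 + 1 / p.2.2))⁻¹) ^ (n + 1) / (p.1 * p.2.1 * p.2.2)))
      = ENNReal.ofReal (besselMoment n) := by
  have hS : MeasurableSet (Ioi (0 : ℝ) ×ˢ Ioi (0 : ℝ)) := measurableSet_Ioi.prod measurableSet_Ioi
  rw [← lintegral_lintegral_besselMoment,
    ← setLIntegral_congr_fun (measurableSet_Ioi.prod hS)
      fun p hp ↦ lintegral_schwingerKernel_parameters n hp,
    lintegral_lintegral_swap (measurable_schwingerKernel n).aemeasurable,
    setLIntegral_congr_fun hS fun q hq ↦ lintegral_schwingerKernel_space n hq,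
    Measure.volume_eq_prod, ← Measure.prod_restrict, lintegral_prod]
  have h2 := measurable_lintegral_exp_sub_div.comp
    (measurable_mul : Measurable fun q : ℝ × ℝ ↦ q.1 * q.2)
  simp only [Function.comp_def] at h2
  refine Measurable.aemeasurable ?_
  fun_prop

/-- The Taylor coefficients at `0` of the three-banana integral are Bessel moments. -/
lemma integral_inv_pow_eq_besselMoment (n : ℕ) :
    ∫ p in Ioi (0 : ℝ) ×ˢ (Ioi (0 : ℝ) ×ˢ Ioi (0 : ℝ)),
        (((1 + p.1 + p.2.1 + p.2.2)
        * (1 + 1 / p.1 + 1 / p.2.1 + 1 / p.2.2))⁻¹) ^ (n + 1) / (p.1 * p.2.1 * p.2.2)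
      = besselMoment n / (n.factorial : ℝ) ^ 2 := by
  have hS : MeasurableSet (Ioi (0 : ℝ) ×ˢ (Ioi (0 : ℝ) ×ˢ Ioi (0 : ℝ))) :=
    measurableSet_Ioi.prod (measurableSet_Ioi.prod measurableSet_Ioi)
  have h0 : 0 ≤ besselMoment n := by
    refine setIntegral_nonneg measurableSet_Ioi fun s hs ↦ ?_
    have hs : 0 < s := hs
    have := expInvIntegral_nonneg 1 s
    positivity
  rw [eq_div_iff (by positivity), mul_comm, ← integral_const_mul,
    integral_eq_lintegral_of_nonneg_ae, lintegral_inv_pow_eq_besselMoment, ENNReal.toReal_ofReal h0]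
  · filter_upwards [ae_restrict_mem hS] with p hp
    obtain ⟨hx : 0 < p.1, hy : 0 < p.2.1, hz : 0 < p.2.2⟩ := hp
    show 0 ≤ _
    positivity
  · exact Measurable.aestronglyMeasurable (by fun_prop)

lemma integrableOn_inv_banana :
    IntegrableOn (fun p : ℝ × ℝ × ℝ ↦ ((1 + p.1 + p.2.1 + p.2.2)
        * (1 + 1 / p.1 + 1 / p.2.1 + 1 / p.2.2))⁻¹ / (p.1 * p.2.1 * p.2.2))
      (Ioi (0 : ℝ) ×ˢ (Ioi (0 : ℝ) ×ˢ Ioi (0 : ℝ))) := by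
  have hS : MeasurableSet (Ioi (0 : ℝ) ×ˢ (Ioi (0 : ℝ) ×ˢ Ioi (0 : ℝ))) :=
    measurableSet_Ioi.prod (measurableSet_Ioi.prod measurableSet_Ioi)
  refine ⟨Measurable.aestronglyMeasurable (by fun_prop), ?_⟩
  rw [hasFiniteIntegral_iff_ofReal]
  · have := lintegral_inv_pow_eq_besselMoment 0
    simp only [Nat.factorial_zero, Nat.cast_one, one_pow, one_mul, zero_add, pow_one] at this
    rw [this]
    exact ENNReal.ofReal_lt_top
  · filter_upwards [ae_restrict_mem hS] with p hp
    obtain ⟨hx : 0 < p.1, hy : 0 < p.2.1, hz : 0 < p.2.2⟩ := hp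
    show 0 ≤ _
    positivity

end MomentFormula

section PowerSeries

open Set Filter Real Topology

lemma sixteen_le_mul_add_inv {x y z : ℝ} (hx : 0 < x) (hy : 0 < y) (hz : 0 < z) :
    16 ≤ (1 + x + y + z) * (1 + 1 / x + 1 / y + 1 / z) := by
  have h (u v : ℝ) (hu : 0 < u) (hv : 0 < v) : 2 ≤ u / v + v / u := by
    rw [div_add_div _ _ hv.ne' hu.ne', le_div_iff₀ (by positivity)]
    nlinarith [sq_nonneg (u - v)]
  have e : (1 + x + y + z) * (1 + 1 / x + 1 / y + 1 / z) = 4 + (x / 1 + 1 / x) + (y / 1 + 1 / y)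
      + (z / 1 + 1 / z) + (x / y + y / x) + (x / z + z / x) + (y / z + z / y) := by
    field_simp
    ring
  linarith [h x 1 hx one_pos, h y 1 hy one_pos, h z 1 hz one_pos, h x y hx hy, h x z hx hz,
    h y z hy hz]

lemma integrable_inv_sub {α : Type*} [MeasurableSpace α] {μ : Measure α} {P w : α → ℝ} {R : ℝ}
    (hR : 0 < R) (hPm : Measurable P) (hwm : Measurable w) (hP : ∀ᵐ a ∂μ, R ≤ P a)
    (hi : Integrable (fun a ↦ (P a)⁻¹ / w a) μ) {t : ℝ} (ht : t < R) :
    Integrable (fun a ↦ (P a - t)⁻¹ / w a) μ := by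
  have ht' : 0 < R - t := sub_pos.2 ht
  refine (hi.norm.const_mul (1 + |t| / (R - t))).mono'
    (Measurable.aestronglyMeasurable (by fun_prop)) ?_
  filter_upwards [hP] with a ha
  have h1 : 0 < P a := hR.trans_le ha
  have h2 : 0 < P a - t := by linarith
  rw [norm_div, norm_div, ← mul_div_assoc, norm_of_nonneg (inv_pos.2 h1).le,
    norm_of_nonneg (inv_pos.2 h2).le]
  gcongr
  have h3 : (P a - t)⁻¹ = (1 + t / (P a - t)) * (P a)⁻¹ := by
    field_simp
    ring
  rw [h3]
  gcongr
  · exact le_abs_self t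

lemma hasSum_integral_inv_sub {α : Type*} [MeasurableSpace α] {μ : Measure α} {P w : α → ℝ} {R : ℝ}
    (hR : 0 < R) (hPm : Measurable P) (hwm : Measurable w) (hP : ∀ᵐ a ∂μ, R ≤ P a)
    (hi : Integrable (fun a ↦ (P a)⁻¹ / w a) μ) {t₀ t : ℝ} (ht₀ : t₀ < R)
    (ht : |t - t₀| < R - t₀) :
    HasSum (fun n : ℕ ↦ (∫ a, (P a - t₀)⁻¹ ^ (n + 1) / w a ∂μ) * (t - t₀) ^ n)
      (∫ a, (P a - t)⁻¹ / w a ∂μ) := by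
  have hd : 0 < R - t₀ := sub_pos.2 ht₀
  have hi₀ := integrable_inv_sub hR hPm hwm hP hi ht₀
  have hb (n : ℕ) : ∀ᵐ a ∂μ, ‖(P a - t₀)⁻¹ ^ (n + 1) / w a * (t - t₀) ^ n‖
      ≤ (|t - t₀| / (R - t₀)) ^ n * ‖(P a - t₀)⁻¹ / w a‖ := by
    filter_upwards [hP] with a ha
    have h2 : R - t₀ ≤ P a - t₀ := by linarith
    have h3 : 0 < P a - t₀ := hd.trans_le h2
    calc ‖(P a - t₀)⁻¹ ^ (n + 1) / w a * (t - t₀) ^ n‖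
        = (|t - t₀| / (P a - t₀)) ^ n * ‖(P a - t₀)⁻¹ / w a‖ := by
          rw [norm_mul, norm_div, norm_div, norm_pow, norm_pow, norm_inv, norm_eq_abs (P a - t₀),
            norm_eq_abs (t - t₀), abs_of_pos h3, inv_pow, div_pow, pow_succ]
          field_simp
      _ ≤ _ := by gcongr
  have hF (n : ℕ) : Integrable (fun a ↦ (P a - t₀)⁻¹ ^ (n + 1) / w a * (t - t₀) ^ n) μ :=
    (hi₀.norm.const_mul _).mono' (Measurable.aestronglyMeasurable (by fun_prop)) (hb n)
  have hr : |t - t₀| / (R - t₀) < 1 := (div_lt_one hd).2 ht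
  have hs : Summable fun n : ℕ ↦ ∫ a, ‖(P a - t₀)⁻¹ ^ (n + 1) / w a * (t - t₀) ^ n‖ ∂μ := by
    refine Summable.of_nonneg_of_le (fun n ↦ integral_nonneg fun a ↦ norm_nonneg _) (fun n ↦ ?_)
      ((summable_geometric_of_lt_one (by positivity) hr).mul_right
        (∫ a, ‖(P a - t₀)⁻¹ / w a‖ ∂μ))
    rw [← integral_const_mul]
    exact integral_mono_ae (hF n).norm (hi₀.norm.const_mul _) (hb n)
  have key := hasSum_integral_of_summable_integral_norm hF hs
  simp only [integral_mul_const] at key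
  refine (integral_congr_ae ?_ : _ = ∫ a, (P a - t)⁻¹ / w a ∂μ) ▸ key
  filter_upwards [hP] with a ha
  have h2 : R - t₀ ≤ P a - t₀ := by linarith
  have h3 : 0 < P a - t₀ := hd.trans_le h2
  have h4 : 0 < P a - t := by linarith [(abs_lt.1 ht).2]
  have hq : |(t - t₀) / (P a - t₀)| < 1 := by
    rw [abs_div, abs_of_pos h3, div_lt_one h3]
    linarith
  have hg := (hasSum_geometric_of_abs_lt_one hq).mul_left ((P a - t₀)⁻¹ / w a)
  have e (n : ℕ) : (P a - t₀)⁻¹ ^ (n + 1) / w a * (t - t₀) ^ n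
      = (P a - t₀)⁻¹ / w a * ((t - t₀) / (P a - t₀)) ^ n := by
    rw [div_pow, inv_pow, pow_succ]
    field_simp
  simp only [e]
  rw [hg.tsum_eq, one_sub_div h3.ne', inv_div, div_mul_div_comm, inv_mul_cancel₀ h3.ne',
    show P a - t₀ - (t - t₀) = P a - t by ring, div_mul_eq_div_div_swap, one_div]

lemma hasFPowerSeriesAt_of_eventually_hasSum {a : ℕ → ℝ} {f : ℝ → ℝ} {t₀ : ℝ}
    (h : ∀ᶠ t in 𝓝 t₀, HasSum (fun n ↦ a n * (t - t₀) ^ n) (f t)) :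
    HasFPowerSeriesAt f (FormalMultilinearSeries.ofScalars ℝ a) t₀ := by
  rw [hasFPowerSeriesAt_iff']
  filter_upwards [h] with t ht
  simpa [FormalMultilinearSeries.coeff_ofScalars, mul_comm] using ht

lemma eventually_hasSum_deriv {a : ℕ → ℝ} {f : ℝ → ℝ}
    (h : ∀ᶠ t in 𝓝 0, HasSum (fun n ↦ a n * t ^ n) (f t)) :
    ∀ᶠ t in 𝓝 0, HasSum (fun n : ℕ ↦ ((n + 1) * a (n + 1)) * t ^ n) (deriv f t) := by
  obtain ⟨r, hr⟩ := hasFPowerSeriesAt_of_eventually_hasSum (t₀ := 0) (by simpa using h)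
  have h2 := hasFPowerSeriesAt_iff'.1 hr.fderiv.hasFPowerSeriesAt
  filter_upwards [h2] with t ht
  have h3 := (ContinuousLinearMap.apply ℝ ℝ (1 : ℝ)).hasSum ht
  simp only [sub_zero, ContinuousLinearMap.apply_apply, smul_apply,
    fderiv_apply_one_eq_deriv,
    FormalMultilinearSeries.derivSeries_coeff_one, FormalMultilinearSeries.coeff_ofScalars] at h3
  have e (n : ℕ) : (n + 1) * a (n + 1) * t ^ n = t ^ n • (n + 1) • a (n + 1) := by
    simp [mul_comm]
  simp only [e]
  exact h3

/-- The coefficients of `X` times a power series. -/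
def shiftCoeff (a : ℕ → ℝ) : ℕ → ℝ
  | 0 => 0
  | n + 1 => a n

lemma hasSum_mul_shift {a : ℕ → ℝ} {t S : ℝ} (h : HasSum (fun n ↦ a n * t ^ n) S) :
    HasSum (fun n ↦ shiftCoeff a n * t ^ n) (t * S) := by
  rw [← hasSum_nat_add_iff' 1]
  have e (n : ℕ) : shiftCoeff a (n + 1) * t ^ (n + 1) = t * (a n * t ^ n) := by
    simp only [shiftCoeff]
    ring
  simp only [e]
  simpa [shiftCoeff] using h.mul_left t

end PowerSeries

section Banana

open Set Filter Real Topology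

lemma hasSum_bananaI {t₀ t : ℝ} (ht₀ : t₀ < 16) (ht : |t - t₀| < 16 - t₀) :
    HasSum (fun n : ℕ ↦ (∫ p in Ioi (0 : ℝ) ×ˢ (Ioi (0 : ℝ) ×ˢ Ioi (0 : ℝ)),
        (((1 + p.1 + p.2.1 + p.2.2) * (1 + 1 / p.1 + 1 / p.2.1 + 1 / p.2.2) - t₀)⁻¹) ^ (n + 1)
          / (p.1 * p.2.1 * p.2.2)) * (t - t₀) ^ n)
      (bananaI t) := by
  refine hasSum_integral_inv_sub (R := 16)
    (P := fun p : ℝ × ℝ × ℝ ↦ (1 + p.1 + p.2.1 + p.2.2) * (1 + 1 / p.1 + 1 / p.2.1 + 1 / p.2.2))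
    (w := fun p : ℝ × ℝ × ℝ ↦ p.1 * p.2.1 * p.2.2)
    (by norm_num) (by fun_prop) (by fun_prop) ?_ integrableOn_inv_banana ht₀ ht
  filter_upwards [ae_restrict_mem
    (measurableSet_Ioi.prod (measurableSet_Ioi.prod measurableSet_Ioi))] with p hp
  exact sixteen_le_mul_add_inv hp.1 hp.2.1 hp.2.2

lemma analyticOnNhd_bananaI : AnalyticOnNhd ℝ bananaI (Iio 16) := by
  intro t₀ ht₀
  have ht₀ : t₀ < 16 := ht₀
  have h : ∀ᶠ t in 𝓝 t₀, |t - t₀| < 16 - t₀ := by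
    filter_upwards [Metric.ball_mem_nhds t₀ (sub_pos.2 ht₀)] with t ht
    simpa [Real.dist_eq] using ht
  exact (hasFPowerSeriesAt_of_eventually_hasSum
    (h.mono fun t ht ↦ hasSum_bananaI ht₀ ht)).analyticAt

lemma eventually_hasSum_bananaI :
    ∀ᶠ t in 𝓝 0, HasSum (fun n : ℕ ↦ besselMoment n / (n.factorial : ℝ) ^ 2 * t ^ n)
      (bananaI t) := by
  refine Metric.eventually_nhds_iff.2 ⟨16, by norm_num, fun t ht ↦ ?_⟩
  have h := hasSum_bananaI (t₀ := 0) (t := t) (by norm_num) (by simpa [Real.dist_eq] using ht)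
  simpa only [sub_zero, integral_inv_pow_eq_besselMoment] using h

lemma coeff_zero_relation {c : ℕ → ℝ} (hc : c = fun n ↦ besselMoment n / (n.factorial : ℝ) ^ 2) :
    -4 * c 0 + 64 * c 1 = -24 := by
  simpa [hc] using besselMoment_zero_relation

lemma coeff_succ_relation {c : ℕ → ℝ} (hc : c = fun n ↦ besselMoment n / (n.factorial : ℝ) ^ 2)
    (n : ℕ) :
    ((n : ℝ) + 1) ^ 3 * c n - 2 * (2 * n + 3) * (5 * (n + 1) ^ 2 + 5 * n + 7) * c (n + 1)
      + 64 * (n + 2) ^ 3 * c (n + 2) = 0 := by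
  have h := besselMoment_succ_relation n
  have hn : (n.factorial : ℝ) ≠ 0 := by positivity
  simp only [hc, Nat.factorial_succ]
  push_cast
  field_simp
  linear_combination ((n : ℝ) + 2) ^ 2 * h

lemma picardFuchs_eventually :
    ∀ᶠ t in 𝓝 (0 : ℝ),
      t^2*(t-4)*(t-16) * deriv (deriv (deriv bananaI)) t
        + 6*t*(t^2 - 15*t + 32) * deriv (deriv bananaI) t
        + (7*t^2 - 68*t + 64) * deriv bananaI t
        + (t-4) * bananaI t = -24 := by
  have h0 := eventually_hasSum_bananaI
  have hz := coeff_zero_relation rfl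
  have hs := coeff_succ_relation rfl
  generalize (fun n : ℕ ↦ besselMoment n / (n.factorial : ℝ) ^ 2) = c at h0 hz hs
  have h1 := eventually_hasSum_deriv h0
  have h2 := eventually_hasSum_deriv h1
  have h3 := eventually_hasSum_deriv h2
  filter_upwards [h0, h1, h2, h3] with t h0 h1 h2 h3
  have h01 := hasSum_mul_shift h0
  have h11 := hasSum_mul_shift h1
  have h12 := hasSum_mul_shift h11
  have h21 := hasSum_mul_shift h2
  have h22 := hasSum_mul_shift h21
  have h23 := hasSum_mul_shift h22
  have h32 := hasSum_mul_shift (hasSum_mul_shift h3)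
  have h33 := hasSum_mul_shift h32
  have h34 := hasSum_mul_shift h33
  have H := (((((((((h34.add (h33.mul_left (-20))).add (h32.mul_left 64)).add
    (h23.mul_left 6)).add (h22.mul_left (-90))).add (h21.mul_left 192)).add
    (h12.mul_left 7)).add (h11.mul_left (-68))).add (h1.mul_left 64)).add h01).add
    (h0.mul_left (-4))
  have H0 := hasSum_single (f := fun n : ℕ ↦ (if n = 0 then (-24 : ℝ) else 0)) 0
    (fun n hn ↦ if_neg hn)
  refine Eq.trans ?_ ((H.congr_fun fun n ↦ ?_).unique H0)
  · ring
  · rcases n with _ | _ | _ | _ | n <;> simp only [shiftCoeff]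
    · simp
      linear_combination -hz
    · have := hs 0
      norm_num at this ⊢
      linear_combination -t * this
    · have := hs 1
      norm_num at this ⊢
      linear_combination -t ^ 2 * this
    · have := hs 2
      norm_num at this ⊢
      linear_combination -t ^ 3 * this
    · have := hs (n + 3)
      simp only [Nat.add_eq_zero_iff, reduceCtorEq] at this ⊢
      push_cast at this ⊢
      simp
      linear_combination -t ^ (n + 4) * this

end Banana

theorem stmt3 :
    (∀ t ∈ Set.Iio (16:ℝ),
      DifferentiableAt ℝ bananaI t ∧
      DifferentiableAt ℝ (deriv bananaI) t ∧
      DifferentiableAt ℝ (deriv (deriv bananaI)) t) ∧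
    (∀ t ∈ Set.Iio (16:ℝ),
      t^2*(t-4)*(t-16) * deriv (deriv (deriv bananaI)) t
        + 6*t*(t^2 - 15*t + 32) * deriv (deriv bananaI) t
        + (7*t^2 - 68*t + 64) * deriv bananaI t
        + (t-4) * bananaI t = -24) := by
  have h0 := analyticOnNhd_bananaI
  have h1 := h0.deriv
  have h2 := h1.deriv
  have h3 := h2.deriv
  refine ⟨fun t ht ↦ ⟨(h0 t ht).differentiableAt, (h1 t ht).differentiableAt,
    (h2 t ht).differentiableAt⟩, ?_⟩
  have hL : AnalyticOnNhd ℝ (fun t ↦ t^2*(t-4)*(t-16) * deriv (deriv (deriv bananaI)) t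
        + 6*t*(t^2 - 15*t + 32) * deriv (deriv bananaI) t
        + (7*t^2 - 68*t + 64) * deriv bananaI t
        + (t-4) * bananaI t) (Set.Iio 16) := by
    intro t ht
    have a0 := h0 t ht
    have a1 := h1 t ht
    have a2 := h2 t ht
    have a3 := h3 t ht
    fun_prop
  exact hL.eqOn_of_preconnected_of_eventuallyEq analyticOnNhd_const isPreconnected_Iio
    (z₀ := 0) (by norm_num) picardFuchs_eventually
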